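/- arXiv:1707.09239 — 2 statements merged into one kernel-verified Lean document; each statement's English description precedes it below -/
import Mathlib

section
/- A K-regular matrix M ∈ Mₙ(K) admits a unique decomposition M = H + V + N where H, V, N ∈ Mₙ(K) commute pairwise, H is diagonalizable over K, V is semisimple with all eigenvalues in Ker(H_K), and N is nilpotent; moreover H + V and N are respectively the semisimple and nilpotent parts of the Jordan–Chevalley decomposition of M. -/
open Polynomial

/-- K-regular: degree over K not divisible by the characteristic. -/
def KReg (K : Type*) [Field K] (x : AlgebraicClosure K) : Prop :=
  ¬ (ringChar K ∣ (minpoly K x).natDegree)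

/-- The K-projection `H_K(λ) = -a_{d-1}/d`. -/
noncomputable def HK (K : Type*) [Field K] (x : AlgebraicClosure K) : K :=
  -(minpoly K x).coeff ((minpoly K x).natDegree - 1) / ((minpoly K x).natDegree : K)

/-- A matrix is diagonalizable over a field `L` if it is conjugate to a diagonal matrix. -/
def IsDiagonalizable {L : Type*} [Field L] {m : ℕ} (A : Matrix (Fin m) (Fin m) L) : Prop :=
  ∃ P D : Matrix (Fin m) (Fin m) L, IsUnit P ∧ D.IsDiag ∧ A = P * D * P⁻¹

/-- A matrix over `K` is semisimple if it is diagonalizable over the algebraic closure. -/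
noncomputable def IsSemisimpleMat {K : Type*} [Field K] {m : ℕ}
    (A : Matrix (Fin m) (Fin m) K) : Prop :=
  IsDiagonalizable (A.map (algebraMap K (AlgebraicClosure K)))

/-- The conditions of a complete additive Jordan-Chevalley decomposition over `K`:
`M = H + V + N` with `H, V, N` pairwise commuting, `H` diagonalizable over `K`,
`V` semisimple with all eigenvalues in `Ker(H_K)`, and `N` nilpotent. -/
noncomputable def IsCAJC {K : Type*} [Field K] {m : ℕ} (M : Matrix (Fin m) (Fin m) K)
    (T : Matrix (Fin m) (Fin m) K × Matrix (Fin m) (Fin m) K × Matrix (Fin m) (Fin m) K) :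
    Prop :=
  M = T.1 + T.2.1 + T.2.2 ∧
  Commute T.1 T.2.1 ∧ Commute T.1 T.2.2 ∧ Commute T.2.1 T.2.2 ∧
  IsDiagonalizable T.1 ∧
  IsSemisimpleMat T.2.1 ∧
  (∀ lam : AlgebraicClosure K, aeval lam (minpoly K T.2.1) = 0 →
    KReg K lam ∧ HK K lam = 0) ∧
  IsNilpotent T.2.2


section aux15

variable {L : Type*} [Field L] {R : Type*} [Ring R] [Algebra L R]

theorem aux_eig {A E : R} {c : L} (h : A * E = c • E) (p : L[X]) :
    aeval A p * E = p.eval c • E := by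
  induction p using Polynomial.induction_on' with
  | add p q hp hq => simp [add_mul, add_smul, hp, hq]
  | monomial k a =>
    have : A ^ k * E = c ^ k • E := by
      induction k with
      | zero => simp
      | succ k ih => rw [pow_succ', mul_assoc, ih, mul_smul_comm, h, smul_smul, pow_succ]
    rw [aeval_monomial, eval_monomial, mul_assoc, this, mul_smul_comm, ← Algebra.smul_def,
      smul_smul, mul_comm]

theorem aux_kill {ι : Type*} {s : Finset ι} {E : ι → R} (hE : ∑ i ∈ s, E i = 1) {A B : R}
    (h : ∀ i ∈ s, A * E i = B * E i) : A = B := by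
  rw [← mul_one A, ← mul_one B, ← hE, Finset.mul_sum, Finset.mul_sum]
  exact Finset.sum_congr rfl h

theorem aux_idem {A : R} {s : Finset L} (h : aeval A (∏ c ∈ s, (X - C c)) = 0) :
    ∃ e : L → L[X], ∑ c ∈ s, aeval A (e c) = 1 ∧
      ∀ c ∈ s, A * aeval A (e c) = c • aeval A (e c) := by
  classical
  rcases s.eq_empty_or_nonempty with rfl | hs
  · refine ⟨fun _ => 0, ?_, by simp⟩
    simpa using h.symm
  refine ⟨fun c => Lagrange.basis s id c, ?_, ?_⟩
  · rw [← map_sum, Lagrange.sum_basis (v := id) Function.injective_id.injOn hs, map_one]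
  · intro c hc
    have key : (X - C c) * Lagrange.basis s id c
        = C (∏ j ∈ s.erase c, (c - j)⁻¹) * ∏ c ∈ s, (X - C c) := by
      rw [← Finset.mul_prod_erase s _ hc, Lagrange.basis, map_prod]
      simp only [Lagrange.basisDivisor, id, Finset.prod_mul_distrib]
      ring
    have := congrArg (aeval A) key
    rw [map_mul, map_mul _ (C _), h, mul_zero, map_sub, aeval_X, aeval_C, sub_mul, sub_eq_zero] at this
    rw [this, Algebra.smul_def]

theorem aux_pair {A B : R} (hAB : Commute A B) {s t : Finset L}
    (hA : aeval A (∏ c ∈ s, (X - C c)) = 0) (hB : aeval B (∏ c ∈ t, (X - C c)) = 0) :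
    ∃ E : L × L → R, ∑ k ∈ s ×ˢ t, E k = 1 ∧
      ∀ k ∈ s ×ˢ t, A * E k = k.1 • E k ∧ B * E k = k.2 • E k := by
  obtain ⟨e, he, he'⟩ := aux_idem hA
  obtain ⟨f, hf, hf'⟩ := aux_idem hB
  have hc : ∀ p : L[X], Commute B (aeval A p) := fun p => by
    induction p using Polynomial.induction_on' with
    | add p q hp hq => rw [map_add]; exact hp.add_right hq
    | monomial k a =>
      rw [aeval_monomial]
      exact (Algebra.commute_algebraMap_right a B).mul_right (hAB.symm.pow_right k)
  refine ⟨fun k => aeval A (e k.1) * aeval B (f k.2), ?_, ?_⟩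
  · simp only [Finset.sum_product]
    rw [← Finset.sum_mul_sum, he, hf, one_mul]
  · intro k hk
    rw [Finset.mem_product] at hk
    refine ⟨?_, ?_⟩
    · rw [← mul_assoc, he' _ hk.1, smul_mul_assoc]
    · rw [← mul_assoc, (hc _).eq, mul_assoc, hf' _ hk.2, mul_smul_comm]

theorem aux_sum {A B : R} (hAB : Commute A B)
    (hA : ∃ s : Finset L, aeval A (∏ c ∈ s, (X - C c)) = 0)
    (hB : ∃ s : Finset L, aeval B (∏ c ∈ s, (X - C c)) = 0) :
    ∃ s : Finset L, aeval (A + B) (∏ c ∈ s, (X - C c)) = 0 := by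
  classical
  obtain ⟨s, hs⟩ := hA
  obtain ⟨t, ht⟩ := hB
  obtain ⟨E, hE, hE'⟩ := aux_pair hAB hs ht
  refine ⟨(s ×ˢ t).image (fun k => k.1 + k.2), ?_⟩
  refine aux_kill hE fun k hk => ?_
  have h1 : (A + B) * E k = (k.1 + k.2) • E k := by
    rw [add_mul, (hE' k hk).1, (hE' k hk).2, add_smul]
  rw [aux_eig h1, eval_prod, Finset.prod_eq_zero (Finset.mem_image_of_mem _ hk) (by simp)]
  simp

theorem aux_uniq {A B : R} (hAB : Commute A B)
    (hA : ∃ s : Finset L, aeval A (∏ c ∈ s, (X - C c)) = 0)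
    (hB : ∃ s : Finset L, aeval B (∏ c ∈ s, (X - C c)) = 0)
    (hn : IsNilpotent (A - B)) : A = B := by
  classical
  obtain ⟨s, hs⟩ := hA
  obtain ⟨t, ht⟩ := hB
  obtain ⟨E, hE, hE'⟩ := aux_pair hAB hs ht
  refine aux_kill hE fun k hk => ?_
  have h1 : (A - B) * E k = (k.1 - k.2) • E k := by
    rw [sub_mul, (hE' k hk).1, (hE' k hk).2, sub_smul]
  obtain ⟨m, hm⟩ := hn
  have h2 := aux_eig h1 (X ^ m)
  rw [map_pow, aeval_X, hm, zero_mul, eval_pow, eval_X] at h2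
  rcases smul_eq_zero.1 h2.symm with h | h
  · rw [(hE' k hk).1, (hE' k hk).2, sub_eq_zero.1 (eq_zero_of_pow_eq_zero h)]
  · rw [h]; simp

theorem aux_diag_prod {m : ℕ} {A : Matrix (Fin m) (Fin m) L} (h : IsDiagonalizable A) :
    ∃ s : Finset L, aeval A (∏ c ∈ s, (X - C c)) = 0 := by
  classical
  obtain ⟨P, D, hP, hD, rfl⟩ := h
  have hdet : IsUnit P.det := (Matrix.isUnit_iff_isUnit_det P).1 hP
  refine ⟨Finset.univ.image (fun i => D i i), ?_⟩
  have hE : ∑ i : Fin m, P * Matrix.single i i (1 : L) * P⁻¹ = 1 := by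
    rw [← Finset.sum_mul, ← Finset.mul_sum]
    have : ∑ i : Fin m, Matrix.single i i (1 : L) = 1 := by
      ext a b
      simp [Matrix.sum_apply, Matrix.single_apply, Matrix.one_apply, Finset.sum_ite, ite_and]
    rw [this, mul_one, Matrix.mul_nonsing_inv _ hdet]
  refine aux_kill hE fun i _ => ?_
  have h1 : P * D * P⁻¹ * (P * Matrix.single i i (1 : L) * P⁻¹)
      = D i i • (P * Matrix.single i i (1 : L) * P⁻¹) := by
    have h2 : D * Matrix.single i i (1 : L) = D i i • Matrix.single i i (1 : L) := by
      rw [← hD.diagonal_diag]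
      ext a b
      by_cases hai : i = a
      · subst hai; simp [Matrix.diagonal_mul]
      · simp [Matrix.diagonal_mul, Matrix.single_apply, hai]
    calc _ = P * (D * ((P⁻¹ * P) * Matrix.single i i (1 : L))) * P⁻¹ := by
            simp only [mul_assoc]
      _ = _ := by
        rw [Matrix.nonsing_inv_mul _ hdet, one_mul, h2, mul_smul_comm, smul_mul_assoc]
  rw [aux_eig h1, eval_prod,
    Finset.prod_eq_zero (Finset.mem_image_of_mem _ (Finset.mem_univ i)) (by simp)]
  simp

theorem aux_prod_diag {m : ℕ} {A : Matrix (Fin m) (Fin m) L}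
    (h : ∃ s : Finset L, aeval A (∏ c ∈ s, (X - C c)) = 0) : IsDiagonalizable A := by
  classical
  obtain ⟨s, hs⟩ := h
  obtain ⟨e, he, he'⟩ := aux_idem hs
  let S : Set (Fin m → L) := {v | ∃ c : L, A.mulVec v = c • v}
  have hS : ⊤ ≤ Submodule.span L S := by
    intro v _
    have : v = ∑ c ∈ s, (aeval A (e c)).mulVec v := by
      rw [← Matrix.sum_mulVec, he, Matrix.one_mulVec]
    rw [this]
    refine Submodule.sum_mem _ fun c hc => Submodule.subset_span ⟨c, ?_⟩
    rw [Matrix.mulVec_mulVec, he' c hc, Matrix.smul_mulVec]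
  let b0 := Module.Basis.ofSpan hS
  have hb0 : ∀ i, b0 i ∈ S := fun i => Module.Basis.ofSpan_subset hS ⟨i, rfl⟩
  let σ := b0.indexEquiv (Pi.basisFun L (Fin m))
  let b := b0.reindex σ
  have hb : ∀ i, b i ∈ S := fun i => by
    rw [Module.Basis.reindex_apply]; exact hb0 _
  choose d hd using hb
  let P : Matrix (Fin m) (Fin m) L := (Pi.basisFun L (Fin m)).toMatrix b
  have hPe : ∀ i j, P i j = b j i := fun i j => by
    simp [P, Module.Basis.toMatrix_apply]
  have hP : IsUnit P := by
    refine ⟨⟨P, b.toMatrix (Pi.basisFun L (Fin m)), ?_, ?_⟩, rfl⟩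
    · exact Module.Basis.toMatrix_mul_toMatrix_flip _ _
    · exact Module.Basis.toMatrix_mul_toMatrix_flip _ _
  refine ⟨P, Matrix.diagonal d, hP, Matrix.isDiag_diagonal d, ?_⟩
  have hAP : A * P = P * Matrix.diagonal d := by
    ext i j
    rw [Matrix.mul_diagonal, hPe, mul_comm]
    have := congrFun (hd j) i
    rw [Pi.smul_apply, smul_eq_mul] at this
    rw [← this, Matrix.mul_apply, Matrix.mulVec, dotProduct]
    simp only [hPe]
  rw [← hAP, mul_assoc, Matrix.mul_nonsing_inv _ ((Matrix.isUnit_iff_isUnit_det P).1 hP), mul_one]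

end aux15

section aux15b

variable {K : Type*} [Field K]

theorem aux_deg_ne {x : AlgebraicClosure K} (h : KReg K x) :
    ((minpoly K x).natDegree : K) ≠ 0 := fun h0 => h ((ringChar.spec K _).1 h0)

theorem aux_int (x : AlgebraicClosure K) : IsIntegral K x := Algebra.IsIntegral.isIntegral x

theorem aux_deg_pos (x : AlgebraicClosure K) : 0 < (minpoly K x).natDegree :=
  minpoly.natDegree_pos (aux_int x)

theorem aux_sep {x : AlgebraicClosure K} (h : KReg K x) : (minpoly K x).Separable := by
  rw [separable_iff_derivative_ne_zero (minpoly.irreducible (aux_int x))]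
  intro h0
  have h1 := congrArg (fun p => coeff p ((minpoly K x).natDegree - 1)) h0
  have hp := aux_deg_pos x
  simp only [coeff_derivative, coeff_zero] at h1
  rw [Nat.sub_add_cancel hp, coeff_natDegree, (minpoly.monic (aux_int x)).leadingCoeff, one_mul,
    ← Nat.cast_succ, Nat.succ_eq_add_one, Nat.sub_add_cancel hp] at h1
  exact aux_deg_ne h h1

theorem aux_shift_deg (x : AlgebraicClosure K) (a : K) :
    (minpoly K (x + algebraMap K _ a)).natDegree = (minpoly K x).natDegree := by
  rw [minpoly.add_algebraMap, natDegree_comp, natDegree_X_sub_C, mul_one]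

theorem aux_shift_reg {x : AlgebraicClosure K} (h : KReg K x) (a : K) :
    KReg K (x + algebraMap K _ a) := by
  unfold KReg; rw [aux_shift_deg]; exact h

theorem aux_coeff_comp {p : K[X]} (hp : p.Monic) (hd : 0 < p.natDegree) (a : K) :
    (p.comp (X - C a)).coeff (p.natDegree - 1) = p.coeff (p.natDegree - 1) - p.natDegree * a := by
  have h1 : p.comp (X - C a) = taylor (-a) p := by
    rw [taylor_apply, C_neg, sub_eq_add_neg]
  rw [h1, taylor_coeff]
  have h2 : (hasseDeriv (p.natDegree - 1) p).natDegree < 2 := by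
    have := natDegree_hasseDeriv_le p (p.natDegree - 1)
    omega
  rw [eval_eq_sum_range' h2, Finset.sum_range_succ, Finset.sum_range_one, hasseDeriv_coeff,
    hasseDeriv_coeff, zero_add, add_comm 1, Nat.sub_add_cancel hd, coeff_natDegree, hp.leadingCoeff]
  have h3 : p.natDegree.choose (p.natDegree - 1) = p.natDegree := by
    rw [Nat.choose_symm hd, Nat.choose_one_right]
  rw [h3, Nat.choose_self]
  simp
  ring

theorem aux_shift_HK {x : AlgebraicClosure K} (h : KReg K x) (a : K) :
    HK K (x + algebraMap K _ a) = HK K x + a := by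
  have hd := aux_deg_ne h
  unfold HK
  rw [aux_shift_deg, minpoly.add_algebraMap,
    aux_coeff_comp (minpoly.monic (aux_int x)) (aux_deg_pos x)]
  field_simp
  ring

theorem aux_coprime {x y : AlgebraicClosure K} (h : minpoly K x ≠ minpoly K y) :
    IsCoprime (minpoly K x) (minpoly K y) := by
  rw [(minpoly.irreducible (aux_int x)).coprime_iff_not_dvd]
  intro hd
  exact h (eq_of_monic_of_associated (minpoly.monic (aux_int x)) (minpoly.monic (aux_int y))
    ((minpoly.irreducible (aux_int x)).associated_of_dvd (minpoly.irreducible (aux_int y)) hd))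

theorem aux_root_minpoly {x y : AlgebraicClosure K} (h : aeval y (minpoly K x) = 0) :
    minpoly K y = minpoly K x :=
  (minpoly.eq_of_irreducible_of_monic (minpoly.irreducible (aux_int x)) h
    (minpoly.monic (aux_int x))).symm

/-- The separable polynomial and the interpolation polynomial. -/
theorem aux_poly (q : K[X]) (hq : q ≠ 0)
    (hreg : ∀ lam : AlgebraicClosure K, aeval lam q = 0 → KReg K lam) :
    ∃ (r F : K[X]) (k : ℕ), r.Separable ∧ q ∣ r ^ k ∧
      (∀ lam : AlgebraicClosure K, aeval lam r = 0 →
        KReg K lam ∧ aeval lam F = algebraMap K _ (HK K lam)) := by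
  classical
  let T : Finset K[X] := (q.aroots (AlgebraicClosure K)).toFinset.image (minpoly K)
  have hT : ∀ P ∈ T, ∃ x : AlgebraicClosure K, aeval x q = 0 ∧ P = minpoly K x := by
    intro P hP
    simp only [T, Finset.mem_image, Multiset.mem_toFinset, mem_aroots] at hP
    obtain ⟨x, hx, rfl⟩ := hP
    exact ⟨x, hx.2, rfl⟩
  have hcop : ∀ P ∈ T, ∀ Q ∈ T, P ≠ Q → IsCoprime P Q := by
    intro P hP Q hQ hne
    obtain ⟨x, -, rfl⟩ := hT P hP
    obtain ⟨y, -, rfl⟩ := hT Q hQ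
    exact aux_coprime hne
  have hsplit : ∀ P : K[X], ∃ e : K[X], P ∈ T → (P ∣ e - 1) ∧ ∀ Q ∈ T, Q ≠ P → Q ∣ e := by
    intro P
    by_cases hP : P ∈ T
    · have : IsCoprime P (∏ Q ∈ T.erase P, Q) :=
        IsCoprime.prod_right fun Q hQ => hcop P hP Q (Finset.mem_of_mem_erase hQ)
          (Finset.ne_of_mem_erase hQ).symm
      obtain ⟨a, b, hab⟩ := this
      refine ⟨b * ∏ Q ∈ T.erase P, Q, fun _ => ⟨⟨-a, ?_⟩, fun Q hQ hne => ?_⟩⟩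
      · linear_combination hab
      · exact (Finset.dvd_prod_of_mem _ (Finset.mem_erase.2 ⟨hne, hQ⟩)).mul_left _
    · exact ⟨0, fun h => absurd h hP⟩
  choose e he using hsplit
  let cc : K[X] → K := fun P => -P.coeff (P.natDegree - 1) / (P.natDegree : K)
  refine ⟨∏ P ∈ T, P, ∑ P ∈ T, C (cc P) * e P, Multiset.card (q.aroots (AlgebraicClosure K)),
    ?_, ?_, ?_⟩
  · refine separable_prod' hcop fun P hP => ?_
    obtain ⟨x, hx, rfl⟩ := hT P hP
    exact aux_sep (hreg x hx)
  · rw [← map_dvd_map' (algebraMap K (AlgebraicClosure K))]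
    have hs := (IsAlgClosed.splits (q.map (algebraMap K (AlgebraicClosure K)))).eq_prod_roots
    rw [hs]
    have hlc : IsUnit (C (q.map (algebraMap K (AlgebraicClosure K))).leadingCoeff) := by
      rw [isUnit_C, isUnit_iff_ne_zero, leadingCoeff_ne_zero]
      exact (Polynomial.map_ne_zero_iff (algebraMap K (AlgebraicClosure K)).injective).2 hq
    rw [hlc.mul_left_dvd, Polynomial.map_pow]
    have key : ∀ m : Multiset (AlgebraicClosure K), (∀ x ∈ m, aeval x q = 0) →
        (m.map fun a => X - C a).prod ∣
          ((∏ P ∈ T, P).map (algebraMap K (AlgebraicClosure K))) ^ Multiset.card m := by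
      intro m
      induction m using Multiset.induction with
      | empty => intro _; simp
      | cons a m ih =>
        intro hm
        rw [Multiset.map_cons, Multiset.prod_cons, Multiset.card_cons, pow_succ']
        refine mul_dvd_mul ?_ (ih fun x hx => hm x (Multiset.mem_cons_of_mem hx))
        rw [dvd_iff_isRoot, IsRoot.def, eval_map_algebraMap]
        have ha : minpoly K a ∈ T := Finset.mem_image_of_mem _ (by
          rw [Multiset.mem_toFinset, mem_aroots]
          exact ⟨hq, hm a (Multiset.mem_cons_self a m)⟩)
        rw [map_prod]
        exact Finset.prod_eq_zero ha (minpoly.aeval K a)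
    exact key _ fun x hx => (mem_aroots.1 hx).2
  · intro x hx
    rw [map_prod, Finset.prod_eq_zero_iff] at hx
    obtain ⟨P, hP, hPx⟩ := hx
    obtain ⟨y, hy, rfl⟩ := hT P hP
    have hxy := aux_root_minpoly hPx
    refine ⟨?_, ?_⟩
    · have := hreg y hy
      unfold KReg at this ⊢
      rwa [hxy]
    · rw [map_sum, Finset.sum_eq_single (minpoly K y)]
      · have h1 : aeval x (e (minpoly K y)) = 1 := by
          obtain ⟨g, hg⟩ := (he _ hP).1
          have := congrArg (aeval x) hg
          rw [map_mul, hPx, zero_mul, map_sub, map_one, sub_eq_zero] at this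
          exact this
        rw [map_mul, h1, mul_one, aeval_C]
        simp only [cc, HK, hxy]
      · intro Q hQ hne
        obtain ⟨g, hg⟩ := (he Q hQ).2 _ hP hne.symm
        rw [hg, map_mul, map_mul, hPx, zero_mul, mul_zero]
      · exact fun h => absurd hP h

end aux15b

section aux15c

variable {K : Type*} [Field K] {n : ℕ}

theorem aux_newton (M : Matrix (Fin n) (Fin n) K) {P : K[X]} {k : ℕ}
    (sep : P.Separable) (nil : minpoly K M ∣ P ^ k) :
    ∃ g : K[X], aeval (aeval M g) P = 0 ∧ IsNilpotent (M - aeval M g) := by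
  set ff : Algebra.adjoin K {M} := ⟨M, Algebra.self_mem_adjoin_singleton K M⟩
  have nil' : IsNilpotent (aeval ff P) := by
    use k
    obtain ⟨q, hq⟩ := nil
    rw [← map_pow, Subtype.ext_iff]
    simp [ff, hq]
  have sep' : IsUnit (aeval ff (derivative P)) := by
    obtain ⟨a, b, h⟩ : IsCoprime (P ^ k) (derivative P) := sep.pow_left
    replace h : (aeval M b) * (aeval M (derivative P)) = 1 := by
      simpa only [map_add, map_mul, map_one, minpoly.dvd_iff.mp nil, mul_zero, zero_add]
        using (aeval M).congr_arg h
    refine .of_mul_eq_one_right (aeval ff b) (Subtype.ext_iff.mpr ?_)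
    simpa [ff, coe_aeval_mk_apply] using h
  obtain ⟨⟨s, mem⟩, ⟨⟨k, hk⟩, hss⟩, -⟩ := existsUnique_nilpotent_sub_and_aeval_eq_zero nil' sep'
  rw [Algebra.adjoin_singleton_eq_range_aeval] at mem
  obtain ⟨g, rfl⟩ := mem
  refine ⟨g, ?_, k, ?_⟩
  · rwa [Subtype.ext_iff, coe_aeval_mk_apply] at hss
  · rw [Subtype.ext_iff] at hk
    simpa using hk

/-- Base change to the algebraic closure. -/
noncomputable def auxPhi (K : Type*) [Field K] (n : ℕ) :
    Matrix (Fin n) (Fin n) K →ₐ[K] Matrix (Fin n) (Fin n) (AlgebraicClosure K) :=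
  (Algebra.ofId K (AlgebraicClosure K)).mapMatrix

theorem auxPhi_apply (A : Matrix (Fin n) (Fin n) K) :
    auxPhi K n A = A.map (algebraMap K (AlgebraicClosure K)) := rfl

theorem auxPhi_inj : Function.Injective (auxPhi K n) :=
  Matrix.map_injective (algebraMap K (AlgebraicClosure K)).injective

theorem auxPhi_aeval (A : Matrix (Fin n) (Fin n) K) (p : K[X]) :
    aeval (auxPhi K n A) (p.map (algebraMap K (AlgebraicClosure K))) = auxPhi K n (aeval A p) := by
  rw [aeval_map_algebraMap, aeval_algHom_apply]

theorem auxPhi_eig {A : Matrix (Fin n) (Fin n) K}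
    {E : Matrix (Fin n) (Fin n) (AlgebraicClosure K)} {c : AlgebraicClosure K}
    (h : auxPhi K n A * E = c • E) (p : K[X]) :
    auxPhi K n (aeval A p) * E = aeval c p • E := by
  rw [← auxPhi_aeval, aux_eig h, eval_map_algebraMap]

theorem aux_ss_iff (A : Matrix (Fin n) (Fin n) K) : IsSemisimpleMat A ↔
    ∃ s : Finset (AlgebraicClosure K), aeval (auxPhi K n A) (∏ c ∈ s, (X - C c)) = 0 :=
  ⟨fun h => aux_diag_prod h, fun h => aux_prod_diag h⟩

theorem aux_sep_prod {A : Matrix (Fin n) (Fin n) K} {r : K[X]} (hr : r.Separable)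
    (h : aeval A r = 0) : ∃ s : Finset (AlgebraicClosure K), (∀ c ∈ s, aeval c r = 0) ∧
      aeval (auxPhi K n A) (∏ c ∈ s, (X - C c)) = 0 := by
  classical
  let r' := r.map (algebraMap K (AlgebraicClosure K))
  have hr' : r'.Separable := hr.map
  refine ⟨r'.roots.toFinset, fun c hc => ?_, ?_⟩
  · rw [Multiset.mem_toFinset] at hc
    exact (mem_aroots.1 hc).2
  · have h1 : aeval (auxPhi K n A) r' = 0 := by rw [auxPhi_aeval, h, map_zero]
    have h2 := (IsAlgClosed.splits r').eq_prod_roots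
    have h3 : ∏ c ∈ r'.roots.toFinset, (X - C c) = (r'.roots.map fun a => X - C a).prod := by
      rw [Finset.prod, Multiset.toFinset_val, (nodup_roots hr').dedup]
    rw [h2, ← h3, map_mul, aeval_C, ← Algebra.smul_def] at h1
    exact (smul_eq_zero.1 h1).resolve_left (leadingCoeff_ne_zero.2 hr'.ne_zero)

theorem aux_comm_aeval {R : Type*} [Ring R] [Algebra K R] {A B : R} (h : Commute A B) (p : K[X]) :
    Commute A (aeval B p) := by
  induction p using Polynomial.induction_on' with
  | add p q hp hq => rw [map_add]; exact hp.add_right hq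
  | monomial k a =>
    rw [aeval_monomial]
    exact (Algebra.commute_algebraMap_right a A).mul_right (h.pow_right k)

theorem aux_JC_unique {M S N' : Matrix (Fin n) (Fin n) K} {g : K[X]}
    (hss : IsSemisimpleMat (aeval M g)) (hnil : IsNilpotent (M - aeval M g))
    (hM : M = S + N') (hc : Commute S N') (hS : IsSemisimpleMat S) (hN : IsNilpotent N') :
    S = aeval M g := by
  have h1 : Commute S M := by rw [hM]; exact (Commute.refl S).add_right hc
  have h2 : Commute N' M := by rw [hM]; exact hc.symm.add_right (Commute.refl N')
  have h3 : IsNilpotent (S - aeval M g) := by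
    have : S - aeval M g = (M - aeval M g) - N' := by
      conv_rhs => rw [show M - aeval M g - N' = M - N' - aeval M g by abel]
      rw [sub_left_inj, eq_sub_iff_add_eq, ← hM]
    rw [this]
    exact Commute.isNilpotent_sub ((h2.sub_right (aux_comm_aeval h2 g)).symm) hnil hN
  apply auxPhi_inj
  refine aux_uniq ((aux_comm_aeval h1 g).map (auxPhi K n)) ((aux_ss_iff _).1 hS)
    ((aux_ss_iff _).1 hss) ?_
  rw [← map_sub]
  exact h3.map (auxPhi K n)

theorem aux_main (M : Matrix (Fin n) (Fin n) K)
    (hreg : ∀ lam : AlgebraicClosure K, aeval lam (minpoly K M) = 0 → KReg K lam) :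
    ∃ g F : K[X], IsSemisimpleMat (aeval M g) ∧ IsNilpotent (M - aeval M g) ∧
      IsCAJC M (aeval (aeval M g) F, aeval M g - aeval (aeval M g) F, M - aeval M g) ∧
      ∀ H V : Matrix (Fin n) (Fin n) K, Commute H V → IsDiagonalizable H → IsSemisimpleMat V →
        (∀ lam : AlgebraicClosure K, aeval lam (minpoly K V) = 0 → KReg K lam ∧ HK K lam = 0) →
        H + V = aeval M g → H = aeval (aeval M g) F := by
  classical
  obtain ⟨r, F, k, hsep, hdvd, hroot⟩ :=
    aux_poly (minpoly K M) (minpoly.ne_zero (Algebra.IsIntegral.isIntegral M)) hreg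
  obtain ⟨g, hg, hnil⟩ := aux_newton M hsep hdvd
  obtain ⟨s, hs, hsA⟩ := aux_sep_prod hsep hg
  set S := aeval M g with hSdef
  obtain ⟨e, he, he'⟩ := aux_idem hsA
  have hFe : ∀ c ∈ s, auxPhi K n (aeval S F) * aeval (auxPhi K n S) (e c)
      = algebraMap K (AlgebraicClosure K) (HK K c) • aeval (auxPhi K n S) (e c) := fun c hc => by
    rw [auxPhi_eig (he' c hc), (hroot c (hs c hc)).2]
  have hVe : ∀ c ∈ s, auxPhi K n (S - aeval S F) * aeval (auxPhi K n S) (e c)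
      = (c + algebraMap K (AlgebraicClosure K) (-HK K c)) • aeval (auxPhi K n S) (e c) :=
    fun c hc => by
      rw [map_sub, sub_mul, hFe c hc, he' c hc, map_neg, add_smul, neg_smul, sub_eq_add_neg]
  have hSM : Commute S M := (aux_comm_aeval (Commute.refl M) g).symm
  have hSF : Commute S (aeval S F) := aux_comm_aeval (Commute.refl S) F
  have hFM : Commute (aeval S F) M := (aux_comm_aeval hSM.symm F).symm
  refine ⟨g, F, (aux_ss_iff _).2 ⟨s, hsA⟩, hnil, ⟨?_, ?_, ?_, ?_, ?_, ?_, ?_, ?_⟩, ?_⟩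
  · simp only; abel
  · exact hSF.symm.sub_right (Commute.refl _)
  · exact hFM.sub_right hSF.symm
  · exact (hSM.sub_right (Commute.refl _)).sub_left (hFM.sub_right hSF.symm)
  · refine aux_prod_diag ⟨s.image (HK K), ?_⟩
    apply auxPhi_inj
    refine aux_kill he fun c hc => ?_
    rw [auxPhi_eig (hFe c hc), map_prod, Finset.prod_eq_zero (Finset.mem_image_of_mem _ hc)]
    · simp
    · simp
  · refine (aux_ss_iff _).2
      ⟨s.image (fun c => c + algebraMap K (AlgebraicClosure K) (-HK K c)), ?_⟩
    refine aux_kill he fun c hc => ?_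
    rw [aux_eig (hVe c hc), eval_prod, Finset.prod_eq_zero (Finset.mem_image_of_mem _ hc)]
    · simp
    · simp
  · intro lam hlam
    simp only at hlam
    have h1 : aeval (S - aeval S F)
        (∏ c ∈ s, minpoly K (c + algebraMap K (AlgebraicClosure K) (-HK K c))) = 0 := by
      apply auxPhi_inj
      refine aux_kill he fun c hc => ?_
      rw [auxPhi_eig (hVe c hc), map_prod, Finset.prod_eq_zero hc (minpoly.aeval K _)]
      simp
    obtain ⟨q, hq⟩ := minpoly.dvd K _ h1
    have h2 := congrArg (aeval lam) hq
    rw [map_mul, hlam, zero_mul, map_prod, Finset.prod_eq_zero_iff] at h2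
    obtain ⟨c, hc, h3⟩ := h2
    have h4 := aux_root_minpoly h3
    have h5 := aux_shift_reg (hroot c (hs c hc)).1 (-HK K c)
    have h6 := aux_shift_HK (hroot c (hs c hc)).1 (-HK K c)
    rw [add_neg_cancel] at h6
    unfold KReg HK at *
    rw [h4]
    exact ⟨h5, h6⟩
  · exact hnil
  · intro H V hc hH hV hVe hHV
    obtain ⟨t, ht⟩ := aux_diag_prod hH
    obtain ⟨u, hu⟩ := (aux_ss_iff _).1 hV
    have ht' : aeval (auxPhi K n H)
        (∏ c ∈ t.image (algebraMap K (AlgebraicClosure K)), (X - C c)) = 0 := by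
      rw [Finset.prod_image (algebraMap K (AlgebraicClosure K)).injective.injOn]
      have := auxPhi_aeval H (∏ c ∈ t, (X - C c))
      rw [ht, map_zero, Polynomial.map_prod] at this
      simpa using this
    obtain ⟨E, hE, hE'⟩ := aux_pair (hc.map (auxPhi K n)) ht' hu
    apply auxPhi_inj
    refine aux_kill hE fun k hk => ?_
    obtain ⟨hk1, hk2⟩ := hE' k hk
    rw [Finset.mem_product, Finset.mem_image] at hk
    obtain ⟨⟨a, -, ha⟩, -⟩ := hk
    have hS : auxPhi K n S * E k = (k.1 + k.2) • E k := by
      rw [hSdef, ← hHV, map_add, add_mul, hk1, hk2, add_smul]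
    rw [auxPhi_eig hS, hk1]
    by_cases h0 : E k = 0
    · rw [h0]; simp
    have hv : aeval k.2 (minpoly K V) = 0 := by
      have := auxPhi_eig hk2 (minpoly K V)
      rw [minpoly.aeval, map_zero, zero_mul] at this
      exact (smul_eq_zero.1 this.symm).resolve_right h0
    have hr : aeval (k.1 + k.2) r = 0 := by
      have := auxPhi_eig hS r
      rw [hg, map_zero, zero_mul] at this
      exact (smul_eq_zero.1 this.symm).resolve_right h0
    rw [(hroot _ hr).2, ← ha, add_comm, aux_shift_HK (hVe _ hv).1, (hVe _ hv).2, zero_add]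

end aux15c

theorem stmt_15 (K : Type*) [Field K] (n : ℕ) (M : Matrix (Fin n) (Fin n) K)
    (hreg : ∀ lam : AlgebraicClosure K, aeval lam (minpoly K M) = 0 → KReg K lam) :
    (∃! T : Matrix (Fin n) (Fin n) K × Matrix (Fin n) (Fin n) K × Matrix (Fin n) (Fin n) K,
        IsCAJC M T) ∧
    (∀ T, IsCAJC M T →
      ∀ S N' : Matrix (Fin n) (Fin n) K, M = S + N' → Commute S N' →
        IsSemisimpleMat S → IsNilpotent N' → S = T.1 + T.2.1 ∧ N' = T.2.2) := by
  obtain ⟨g, F, hss, hnil, hex, huniq⟩ := aux_main M hreg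
  have key : ∀ T, IsCAJC M T → T.1 + T.2.1 = aeval M g := by
    rintro ⟨H, V, N⟩ ⟨h1, h2, h3, h4, h5, h6, h7, h8⟩
    refine aux_JC_unique hss hnil h1 (h3.add_left h4) ?_ h8
    have hH : IsSemisimpleMat H := by
      obtain ⟨P, D, hP, hD, hH⟩ := h5
      refine ⟨auxPhi K n P, auxPhi K n D, hP.map _, ?_, ?_⟩
      · intro i j hij
        rw [auxPhi_apply, Matrix.map_apply, hD hij, map_zero]
      · have h9 : auxPhi K n P⁻¹ = (auxPhi K n P)⁻¹ := by
          symm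
          apply Matrix.inv_eq_right_inv
          rw [← map_mul, Matrix.mul_nonsing_inv _ ((Matrix.isUnit_iff_isUnit_det P).1 hP), map_one]
        rw [← auxPhi_apply, ← h9, ← map_mul, ← map_mul]
        exact congrArg _ hH
    refine (aux_ss_iff _).2 ?_
    rw [map_add]
    exact aux_sum (h2.map (auxPhi K n)) ((aux_ss_iff _).1 hH) ((aux_ss_iff _).1 h6)
  refine ⟨⟨_, hex, ?_⟩, ?_⟩
  · rintro ⟨H, V, N⟩ hT
    have hk := key _ hT
    obtain ⟨h1, h2, h3, h4, h5, h6, h7, h8⟩ := hT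
    simp only at hk h1 h2 h5 h6 h7
    have hH := huniq H V h2 h5 h6 h7 hk
    have hV : V = aeval M g - aeval (aeval M g) F := by rw [← hH, ← hk]; abel
    have hN : N = M - aeval M g := by rw [← hk]; nth_rewrite 1 [h1]; abel
    rw [← hV, ← hN, ← hH]
  · intro T hT S N' hM hc hS hN
    have hk := key _ hT
    have hSe : S = T.1 + T.2.1 := by rw [hk]; exact aux_JC_unique hss hnil hM hc hS hN
    refine ⟨hSe, ?_⟩
    have h1 := hT.1
    rw [← hSe] at h1
    exact add_left_cancel (hM.symm.trans h1)
end

section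
/- A field K is real closed if and only if every element of K̄ is K-regular and Ker(H_K) equals the one-dimensional K-vector subspace of K̄ generated by a square root of −1. -/
/-- A field `K` is real closed iff `√-1 ∉ K` and `K(√-1)` is algebraically closed
(within a fixed algebraic closure, `K(√-1)` being the whole algebraic closure). -/
def RealClosed (K : Type*) [Field K] : Prop :=
  (¬ ∃ x : K, x ^ 2 = -1) ∧
  ∀ i : AlgebraicClosure K, i ^ 2 = -1 → IntermediateField.adjoin K {i} = ⊤

theorem kreg_ne {K : Type*} [Field K] {x : AlgebraicClosure K} (h : KReg K x) :
    ((minpoly K x).natDegree : K) ≠ 0 := fun h0 => h ((ringChar.spec K _).1 h0)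

theorem isInt' {K : Type*} [Field K] (x : AlgebraicClosure K) : IsIntegral K x :=
  (AlgebraicClosure.isAlgebraic K).isAlgebraic x |>.isIntegral

open Polynomial in
theorem minpoly_shift {K : Type*} [Field K] (x : AlgebraicClosure K) (a : K) :
    minpoly K (x - algebraMap K _ a) = taylor a (minpoly K x) := by
  rw [minpoly.sub_algebraMap, taylor_apply]

open Polynomial in
theorem taylor_coeff_pred {K : Type*} [Field K] (f : K[X]) (hf : f.Monic) (h : 0 < f.natDegree)
    (a : K) : (taylor a f).coeff (f.natDegree - 1) = f.coeff (f.natDegree - 1) + f.natDegree * a := by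
  obtain ⟨n, hn⟩ : ∃ n, f.natDegree = n + 1 := ⟨f.natDegree - 1, by omega⟩
  have hl : f.coeff (n + 1) = 1 := by rw [← hn]; exact hf
  rw [taylor_coeff, hn, Nat.add_sub_cancel, eval_eq_sum_range' (n := 2)]
  · simp [Finset.sum_range_succ, hasseDeriv_coeff, add_comm 1 n, hl, Nat.choose_succ_self_right]
  · have := natDegree_hasseDeriv_le f n
    omega

theorem HK_shift {K : Type*} [Field K] (x : AlgebraicClosure K) (h : KReg K x) (a : K) :
    KReg K (x - algebraMap K _ a) ∧ HK K (x - algebraMap K _ a) = HK K x - a := by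
  have h1 := kreg_ne h
  unfold KReg HK at *
  rw [minpoly_shift, Polynomial.natDegree_taylor, 
    taylor_coeff_pred _ (minpoly.monic (isInt' x)) (minpoly.natDegree_pos (isInt' x))]
  refine ⟨h, ?_⟩
  field_simp
  ring

theorem HK_algebraMap {K : Type*} [Field K] (a : K) :
    KReg K (algebraMap K _ a) ∧ HK K (algebraMap K _ a) = a := by
  unfold KReg HK
  rw [minpoly.eq_X_sub_C]
  simp [not_subsingleton K]

open Polynomial in
theorem HK_i {K : Type*} [Field K] (hK : ¬ ∃ x : K, x ^ 2 = -1) (i : AlgebraicClosure K)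
    (hi : i ^ 2 = -1) (b : K) : KReg K (b • i) ∧ HK K (b • i) = 0 := by
  by_cases hb : b = 0
  · subst hb
    simpa using HK_algebraMap (0 : K)
  have hm : minpoly K (b • i) = X ^ 2 + C (b ^ 2) := by
    symm
    apply minpoly.eq_of_irreducible_of_monic
    · have : (X ^ 2 + C (b ^ 2) : K[X]) = X ^ 2 - C (-b ^ 2) := by simp
      rw [this]
      apply X_pow_sub_C_irreducible_of_prime Nat.prime_two
      intro c hc
      apply hK
      refine ⟨c / b, ?_⟩
      rw [div_pow, hc]
      field_simp
    · rw [Algebra.smul_def]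
      simp [mul_pow, hi]
    · exact monic_X_pow_add_C _ two_ne_zero
  unfold KReg HK
  rw [hm, natDegree_X_pow_add_C]
  refine ⟨fun h => hK ⟨1, ?_⟩, by simp [coeff_X, coeff_C, -map_pow]⟩
  have : ((2 : ℕ) : K) = 0 := (ringChar.spec K 2).2 h
  push_cast at this
  linear_combination this

theorem mem_adj {K : Type*} [Field K] (i : AlgebraicClosure K) (hi : i ^ 2 = -1)
    (x : AlgebraicClosure K) (hx : x ∈ IntermediateField.adjoin K {i}) :
    ∃ a b : K, x = b • i - algebraMap K _ a := by
  rw [← IntermediateField.mem_toSubalgebra,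
    IntermediateField.adjoin_simple_toSubalgebra_of_isAlgebraic (isInt' i).isAlgebraic] at hx
  induction hx using Algebra.adjoin_induction with
  | mem x hx => exact ⟨0, 1, by simpa using hx⟩
  | algebraMap r => exact ⟨-r, 0, by simp⟩
  | add x y _ _ hx hy =>
    obtain ⟨a, b, rfl⟩ := hx
    obtain ⟨c, d, rfl⟩ := hy
    exact ⟨a + c, b + d, by simp only [Algebra.smul_def, map_add]; ring⟩
  | mul x y _ _ hx hy =>
    obtain ⟨a, b, rfl⟩ := hx
    obtain ⟨c, d, rfl⟩ := hy
    refine ⟨b * d - a * c, -(a * d + b * c), ?_⟩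
    simp only [Algebra.smul_def, map_add, map_mul, map_neg, map_sub]
    linear_combination (algebraMap K (AlgebraicClosure K) b * algebraMap K _ d) * hi

theorem stmt_19 (K : Type*) [Field K] :
    RealClosed K ↔
      ((∀ x : AlgebraicClosure K, KReg K x) ∧
        ∃ i : AlgebraicClosure K, i ^ 2 = -1 ∧
          {x : AlgebraicClosure K | KReg K x ∧ HK K x = 0} =
            (Submodule.span K {i} : Submodule K (AlgebraicClosure K))) := by
  constructor
  · rintro ⟨hK, h⟩
    obtain ⟨i, hi⟩ := IsAlgClosed.exists_pow_nat_eq (-1 : AlgebraicClosure K) two_pos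
    have key := fun x => mem_adj i hi x (by rw [h i hi]; trivial)
    refine ⟨fun x => ?_, i, hi, ?_⟩
    · obtain ⟨a, b, rfl⟩ := key x
      exact (HK_shift _ (HK_i hK i hi b).1 a).1
    · ext x
      simp only [Set.mem_setOf_eq, SetLike.mem_coe, Submodule.mem_span_singleton]
      constructor
      · rintro ⟨-, h0⟩
        obtain ⟨a, b, rfl⟩ := key x
        rw [(HK_shift _ (HK_i hK i hi b).1 a).2, (HK_i hK i hi b).2] at h0
        have : a = 0 := by simpa using h0
        exact ⟨b, by simp [this]⟩
      · rintro ⟨b, rfl⟩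
        exact HK_i hK i hi b
  · rintro ⟨hr, i, hi, hS⟩
    have hmem : ∀ x, HK K x = 0 ↔ ∃ b : K, b • i = x := by
      intro x
      rw [← Submodule.mem_span_singleton, ← SetLike.mem_coe, ← hS]
      simp [hr x]
    have hpm : ∀ j : AlgebraicClosure K, j ^ 2 = -1 → j = i ∨ j = -i := fun j hj =>
      sq_eq_sq_iff_eq_or_eq_neg.1 (hj.trans hi.symm)
    refine ⟨?_, ?_⟩
    · rintro ⟨c, hc⟩
      have h0 : HK K (algebraMap K (AlgebraicClosure K) c) = 0 := by
        rw [hmem]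
        rcases hpm (algebraMap K _ c) (by rw [← map_pow, hc]; simp) with h | h
        · exact ⟨1, by simp [h]⟩
        · exact ⟨-1, by simp [h]⟩
      rw [(HK_algebraMap c).2] at h0
      simp [h0] at hc
    · intro j hj
      have hij : i ∈ IntermediateField.adjoin K {j} := by
        have := IntermediateField.mem_adjoin_simple_self K j
        rcases hpm j hj with h | h
        · rwa [h] at this ⊢
        · have h2 := neg_mem this
          rwa [show -j = i by rw [h, neg_neg]] at h2
      rw [eq_top_iff]
      intro x _
      have h0 := (HK_shift x (hr x) (HK K x)).2
      rw [sub_self, hmem] at h0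
      obtain ⟨b, hb⟩ := h0
      rw [← sub_add_cancel x (algebraMap K _ (HK K x)), ← hb, Algebra.smul_def]
      exact add_mem (mul_mem (IntermediateField.algebraMap_mem _ _) hij)
        (IntermediateField.algebraMap_mem _ _)
end
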